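/- The stability condition θ_T is generic for the dimension vector d: every left A-module M, finite-dimensional as a ℂ-vector space with dimension vector d_M = d, that is θ_T-semistable is in fact θ_T-stable. -/

import Mathlib

/-!  Setup: `A` is an associative unital ℂ-algebra, `ι` a finite index type and
`e : ι → A` a family of pairwise orthogonal idempotents summing to `1`.
For a left `A`-module `M`, finite dimensional over ℂ, the dimension vector is
`d_M (i) = dim_ℂ (e i • M)` and `θ(M) = ∑ i, θ i * d_M i`. -/

/-- The ℂ-linear endomorphism of `M` given by the action of `a : A`. -/
noncomputable def actMap (A : Type*) [Ring A] [Algebra ℂ A] (a : A)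
    (M : Type*) [AddCommGroup M] [Module ℂ M] [Module A M] [IsScalarTower ℂ A M] :
    M →ₗ[ℂ] M where
  toFun m := a • m
  map_add' x y := smul_add a x y
  map_smul' c m := smul_comm a c m

/-- The dimension vector of `M` : `d_M (i) = dim_ℂ (image of `e i • ·`)`. -/
noncomputable def dimVec (A : Type*) [Ring A] [Algebra ℂ A] {ι : Type*} (e : ι → A)
    (M : Type*) [AddCommGroup M] [Module ℂ M] [Module A M] [IsScalarTower ℂ A M]
    (i : ι) : ℕ :=
  Module.finrank ℂ (LinearMap.range (actMap A (e i) M))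

/-- `θ(M) = ∑ i, θ i * d_M i`. -/
noncomputable def thetaVal (A : Type*) [Ring A] [Algebra ℂ A] {ι : Type*} [Fintype ι]
    (e : ι → A) (θ : ι → ℤ)
    (M : Type*) [AddCommGroup M] [Module ℂ M] [Module A M] [IsScalarTower ℂ A M] : ℤ :=
  ∑ i, θ i * (dimVec A e M i : ℤ)

/-- `M` is `θ`-semistable if every `A`-submodule `N ⊆ M` satisfies `θ(N) ≥ θ(M)`. -/
def Semistable (A : Type*) [Ring A] [Algebra ℂ A] {ι : Type*} [Fintype ι]
    (e : ι → A) (θ : ι → ℤ)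
    (M : Type*) [AddCommGroup M] [Module ℂ M] [Module A M] [IsScalarTower ℂ A M] : Prop :=
  ∀ N : Submodule A M, thetaVal A e θ N ≥ thetaVal A e θ M

/-- `M` is `θ`-stable if it is `θ`-semistable and no nonzero proper `A`-submodule `N`
satisfies `θ(N) = θ(M)`. -/
def Stable (A : Type*) [Ring A] [Algebra ℂ A] {ι : Type*} [Fintype ι]
    (e : ι → A) (θ : ι → ℤ)
    (M : Type*) [AddCommGroup M] [Module ℂ M] [Module A M] [IsScalarTower ℂ A M] : Prop :=
  Semistable A e θ M ∧
    ∀ N : Submodule A M, N ≠ ⊥ → N ≠ ⊤ → thetaVal A e θ N ≠ thetaVal A e θ M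

/-- The stability condition `θ_T` determined by a dimension vector `d` on `Fin (n+1)`:
`θ_T 0 = -∑_{i ≠ 0} d i` and `θ_T i = 1` for `i ≠ 0`. -/
def thetaT {n : ℕ} (d : Fin (n + 1) → ℕ) : Fin (n + 1) → ℤ := fun i =>
  if i = 0 then -(∑ j ∈ Finset.univ.filter (fun j : Fin (n + 1) => j ≠ 0), (d j : ℤ)) else 1

section Submodules

variable {A : Type*} [Ring A] [Algebra ℂ A] {ι : Type*} (e : ι → A)
  {M : Type*} [AddCommGroup M] [Module ℂ M] [Module A M] [IsScalarTower ℂ A M]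

theorem map_range_actMap_le (a : A) (N : Submodule A M) :
    (LinearMap.range (actMap A a N)).map (N.subtype.restrictScalars ℂ) ≤
      LinearMap.range (actMap A a M) := by
  rintro _ ⟨_, ⟨x, rfl⟩, rfl⟩
  exact ⟨x, rfl⟩

theorem finrank_map_range_actMap (i : ι) (N : Submodule A M) :
    Module.finrank ℂ ((LinearMap.range (actMap A (e i) N)).map (N.subtype.restrictScalars ℂ)) =
      dimVec A e N i :=
  LinearEquiv.finrank_eq (Submodule.equivMapOfInjective (N.subtype.restrictScalars ℂ)
    Subtype.val_injective _).symm

theorem dimVec_submodule_le [FiniteDimensional ℂ M] (N : Submodule A M) (i : ι) :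
    dimVec A e N i ≤ dimVec A e M i := by
  rw [← finrank_map_range_actMap]
  exact Submodule.finrank_mono (map_range_actMap_le (e i) N)

theorem smul_mem_of_dimVec_eq [FiniteDimensional ℂ M] (N : Submodule A M) (i : ι)
    (h : dimVec A e N i = dimVec A e M i) (m : M) : e i • m ∈ N := by
  have hrange := Submodule.eq_of_le_of_finrank_eq (map_range_actMap_le (e i) N)
    ((finrank_map_range_actMap e i N).trans h)
  have hm : e i • m ∈ LinearMap.range (actMap A (e i) M) := ⟨m, rfl⟩
  rw [← hrange] at hm
  obtain ⟨x, -, hx⟩ := hm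
  exact hx ▸ x.2

theorem smul_eq_zero_of_dimVec_eq_zero [FiniteDimensional ℂ M] (i : ι)
    (h : dimVec A e M i = 0) (m : M) : e i • m = 0 := by
  have hrange : LinearMap.range (actMap A (e i) M) = ⊥ := Submodule.finrank_eq_zero.mp h
  exact (Submodule.mem_bot ℂ).mp (hrange ▸ ⟨m, rfl⟩)

variable [Fintype ι] {e}

theorem submodule_eq_top_of_dimVec_eq [FiniteDimensional ℂ M] (hsum : ∑ i, e i = 1)
    (N : Submodule A M) (h : ∀ i, dimVec A e N i = dimVec A e M i) : N = ⊤ := by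
  refine eq_top_iff.mpr fun m _ => ?_
  rw [← one_smul A m, ← hsum, Finset.sum_smul]
  exact N.sum_mem fun i _ => smul_mem_of_dimVec_eq e N i (h i) m

theorem submodule_eq_bot_of_dimVec_eq_zero [FiniteDimensional ℂ M] (hsum : ∑ i, e i = 1)
    (N : Submodule A M) (h : ∀ i, dimVec A e N i = 0) : N = ⊥ := by
  have : FiniteDimensional ℂ N := inferInstanceAs (FiniteDimensional ℂ (N.restrictScalars ℂ))
  refine N.eq_bot_iff.mpr fun m hm => ?_
  have hzero : (⟨m, hm⟩ : N) = 0 := by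
    rw [← one_smul A (⟨m, hm⟩ : N), ← hsum, Finset.sum_smul]
    exact Finset.sum_eq_zero fun i _ => smul_eq_zero_of_dimVec_eq_zero e i (h i) _
  exact congrArg Subtype.val hzero

end Submodules

theorem thetaVal_thetaT {A : Type*} [Ring A] [Algebra ℂ A] {n : ℕ} (e : Fin (n + 1) → A)
    (d : Fin (n + 1) → ℕ)
    (M : Type*) [AddCommGroup M] [Module ℂ M] [Module A M] [IsScalarTower ℂ A M] :
    thetaVal A e (thetaT d) M =
      -(∑ i : Fin n, (d i.succ : ℤ)) * dimVec A e M 0 +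
        ∑ i : Fin n, (dimVec A e M i.succ : ℤ) := by
  simp [thetaVal, thetaT, Fin.sum_univ_succ, Finset.sum_filter, Fin.succ_ne_zero]

/-- `θ_T` is generic for the dimension vector `d`: every `θ_T`-semistable module of
dimension vector `d` is `θ_T`-stable. -/
theorem thetaT_generic (A : Type*) [Ring A] [Algebra ℂ A]
    (n : ℕ) (e : Fin (n + 1) → A)
    (horth : ∀ i j, i ≠ j → e i * e j = 0) (hidem : ∀ i, e i * e i = e i)
    (hsum : ∑ i, e i = 1)
    (d : Fin (n + 1) → ℕ) (hd0 : d 0 = 1)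
    (M : Type*) [AddCommGroup M] [Module ℂ M] [Module A M] [IsScalarTower ℂ A M]
    [FiniteDimensional ℂ M]
    (hdM : ∀ i, dimVec A e M i = d i)
    (hss : Semistable A e (thetaT d) M) :
    Stable A e (thetaT d) M := by
  refine ⟨hss, fun N hbot htop heq => ?_⟩
  have hle : ∀ i, dimVec A e N i ≤ d i := fun i => hdM i ▸ dimVec_submodule_le e N i
  simp only [thetaVal_thetaT, hdM, hd0] at heq
  have hle0 := hle 0
  rw [hd0] at hle0
  obtain h0 | h0 : dimVec A e N 0 = 0 ∨ dimVec A e N 0 = 1 := by lia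
  · refine hbot (submodule_eq_bot_of_dimVec_eq_zero hsum N (Fin.cases h0 fun i => ?_))
    have hzero : ∑ i : Fin n, dimVec A e N i.succ = 0 := by
      rw [h0] at heq
      push_cast at heq
      zify
      linarith
    exact Finset.sum_eq_zero_iff.mp hzero i (Finset.mem_univ i)
  · refine htop (submodule_eq_top_of_dimVec_eq hsum N fun i => (?_ : _ = d i).trans (hdM i).symm)
    have htotal : ∑ i : Fin n, dimVec A e N i.succ = ∑ i : Fin n, d i.succ := by
      rw [h0] at heq
      push_cast at heq
      zify
      linarith
    refine Fin.cases (h0.trans hd0.symm) (fun j => ?_) i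
    exact (Finset.sum_eq_sum_iff_of_le fun j _ => hle j.succ).mp htotal j (Finset.mem_univ j)
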